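/- arXiv:math/0606556 — 2 statements merged into one kernel-verified Lean document; each statement's English description precedes it below -/
import Mathlib

section
/- For every a ∈ GL(m,ℝ), every h ∈ ℝ^{m*} ≅ g₁, and every u ∈ S^k ℝ^m ⊗ Hom(V₁,V₂), one has ρ^(k−1)(a)(γ(h)u) = γ(h∘a^{-1})(ρ^(k)(a)u); here h∘a^{-1} is the adjoint action Ad(a)h of GL(m,ℝ) ⊂ PGL(m+1,ℝ) on g₁ ≅ ℝ^{m*}. -/
open scoped BigOperators
noncomputable section
namespace ProjQuant

/-- `ℝ^m`. -/
abbrev Rm (m : ℕ) := Fin m → ℝ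

/-- The index set for `(m+1) × (m+1)` matrices, split into blocks. -/
abbrev Idx (m : ℕ) := Sum (Fin m) Unit

/-- `gl(m,ℝ)`, realized as continuous linear endomorphisms of `ℝ^m`. -/
abbrev GLm (m : ℕ) := (Fin m → ℝ) →L[ℝ] (Fin m → ℝ)

/-- `ℝ^{m*}`. -/
abbrev Dualm (m : ℕ) := (Fin m → ℝ) →L[ℝ] ℝ

/-- The vector field `X^M` on `ℝ^m` attached to a matrix
`M = [[A, v], [ξ, a]] ∈ sl(m+1,ℝ)`, namely `X^M(x) = -v - A x + a x + ξ(x) x`. -/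
def projVF (m : ℕ) (M : Matrix (Idx m) (Idx m) ℝ) : Rm m → Rm m := fun x i =>
  -(M (Sum.inl i) (Sum.inr ())) - (∑ j, M (Sum.inl i) (Sum.inl j) * x j)
    + M (Sum.inr ()) (Sum.inr ()) * x i
    + (∑ j, M (Sum.inr ()) (Sum.inl j) * x j) * x i

/-- The Lie derivative of a `V`-valued function along a vector field `X`, with respect to a
representation `σ` of `gl(m,ℝ)` on `V`:  `(L_X f)(x) = Df(x)[X(x)] - σ(DX(x))(f(x))`. -/
def lieD (m : ℕ) {V : Type} [NormedAddCommGroup V] [NormedSpace ℝ V]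
    (σ : GLm m → V → V) (X : Rm m → Rm m) (f : Rm m → V) : Rm m → V :=
  fun x => fderiv ℝ f x (X x) - σ (fderiv ℝ X x) (f x)

/-- `σ` is a Lie algebra representation of `gl(m,ℝ)`. -/
def IsLieRep (m : ℕ) {V : Type} [NormedAddCommGroup V] [NormedSpace ℝ V]
    (σ : GLm m →ₗ[ℝ] (V →L[ℝ] V)) : Prop :=
  ∀ A B : GLm m, σ (A ∘L B - B ∘L A) = σ A ∘L σ B - σ B ∘L σ A


/-- Iterated Lie derivative along the constant fields `X^{hᵢ} = -hᵢ`, outermost first. -/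
def lieItC (m : ℕ) {V : Type} [NormedAddCommGroup V] [NormedSpace ℝ V]
    (σ : GLm m → V → V) : (k : ℕ) → (Fin k → Rm m) → (Rm m → V) → (Rm m → V)
  | 0, _, f => f
  | (k+1), v, f => lieD m σ (fun _ => -(v 0)) (lieItC m σ k (fun j => v j.succ) f)

section Symbols

variable (m : ℕ) (V₁ V₂ : Type)
  [NormedAddCommGroup V₁] [NormedSpace ℝ V₁] [NormedAddCommGroup V₂] [NormedSpace ℝ V₂]

/-- The model for `S^k ℝ^m ⊗ Hom(V₁,V₂)`: multilinear maps on `k` copies of `ℝ^{m*}`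
with values in `Hom(V₁,V₂)` (symbols of degree `k` are the symmetric ones). -/
abbrev Symb (k : ℕ) := ContinuousMultilinearMap ℝ (fun _ : Fin k => Dualm m) (V₁ →L[ℝ] V₂)

/-- The decomposable tensor `h₁ ⊗ ⋯ ⊗ h_k ⊗ A` in the model. -/
def pureT {k : ℕ} (v : Fin k → Rm m) (A : V₁ →L[ℝ] V₂) : Symb m V₁ V₂ k :=
  (ContinuousMultilinearMap.mkPiRing ℝ (Fin k) A).compContinuousLinearMap
    (fun i => ContinuousLinearMap.apply ℝ ℝ (v i))

/-- The symmetric product `h₁ ∨ ⋯ ∨ h_k ⊗ A` in the model. -/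
def symT {k : ℕ} (v : Fin k → Rm m) (A : V₁ →L[ℝ] V₂) : Symb m V₁ V₂ k :=
  ∑ ν : Equiv.Perm (Fin k), pureT m V₁ V₂ (v ∘ ν) A

/-- The subspace of the model corresponding to `S^k ℝ^m ⊗ Hom(V₁,V₂)` itself:
the span of the symmetric products. -/
def spanGen (k : ℕ) : Submodule ℝ (Symb m V₁ V₂ k) :=
  Submodule.span ℝ {T | ∃ (v : Fin k → Rm m) (A : V₁ →L[ℝ] V₂), T = symT m V₁ V₂ v A}

/-- The rank-one endomorphism `u ⊗ h : x ↦ h(x) • u` of `ℝ^m`. -/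
def rkOne (u : Rm m) (h : Dualm m) : GLm m := h.smulRight u

variable (σ₁ : GLm m →ₗ[ℝ] (V₁ →L[ℝ] V₁)) (σ₂ : GLm m →ₗ[ℝ] (V₂ →L[ℝ] V₂))

/-- The representation `σ^{(k)}` of `gl(m,ℝ)` on `S^k ℝ^m ⊗ Hom(V₁,V₂)`, determined by
`σ^{(k)}(B)(h₁∨⋯∨h_k ⊗ A) = Σᵢ h₁∨⋯∨(B hᵢ)∨⋯∨h_k ⊗ A + h₁∨⋯∨h_k ⊗ (σ₂(B)∘A - A∘σ₁(B))`. -/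
def sigmaS {k : ℕ} (B : GLm m) (T : Symb m V₁ V₂ k) : Symb m V₁ V₂ k :=
  (∑ t : Fin k, T.compContinuousLinearMap
    (fun s => if s = t then (ContinuousLinearMap.compL ℝ (Rm m) (Rm m) ℝ).flip B
      else ContinuousLinearMap.id ℝ (Dualm m)))
  + ((ContinuousLinearMap.compL ℝ V₁ V₂ V₂ (σ₂ B))
      - (ContinuousLinearMap.compL ℝ V₁ V₁ V₂).flip (σ₁ B)).compContinuousMultilinearMap T

/-- The `i`-th coordinate covector on `ℝ^m`. -/
def coordD (i : Fin m) : Dualm m := ContinuousLinearMap.proj i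

/-- The affine quantization (standard ordering): the full contraction of a degree-`k` symbol
with the `k`-th derivative, `Q_Aff(h₁∨⋯∨h_k ⊗ A)(f) = A(∂_{h₁} ⋯ ∂_{h_k} f)`. -/
def QAff {k : ℕ} (T : Rm m → Symb m V₁ V₂ k) (f : Rm m → V₁) : Rm m → V₂ :=
  fun x => (k.factorial : ℝ)⁻¹ • ∑ d : Fin k → Fin m,
    (T x (fun t => coordD m (d t))) (iteratedFDeriv ℝ k f x (fun t => Pi.single (d t) 1))

/-- The defining property of the map `γ(h) : S^{k+1} ℝ^m ⊗ Hom(V₁,V₂) → S^k ℝ^m ⊗ Hom(V₁,V₂)`,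
for `h ∈ ℝ^{m*} ≅ 𝔤₁`:
`γ(h)(h₁∨⋯∨h_{k+1} ⊗ A) = Σᵢ h₁∨⋯(omit hᵢ)⋯∨h_{k+1} ⊗ (A ∘ σ₁(hᵢ⊗h + h(hᵢ)·Id))`
`- Σᵢ Σ_{j<i} h₁∨⋯(omit hⱼ,hᵢ)⋯∨h_{k+1} ∨ (h(hⱼ)·hᵢ + h(hᵢ)·hⱼ) ⊗ A`. -/
def gammaProp {k : ℕ}
    (γ : Dualm m → (Symb m V₁ V₂ (k+1) →ₗ[ℝ] Symb m V₁ V₂ k)) : Prop :=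
  ∀ (h : Dualm m) (v : Fin (k+1) → Rm m) (A : V₁ →L[ℝ] V₂),
    γ h (symT m V₁ V₂ v A) =
      (∑ i : Fin (k+1), symT m V₁ V₂ (i.removeNth v)
        (A.comp (σ₁ (rkOne m (v i) h + h (v i) • ContinuousLinearMap.id ℝ (Rm m)))))
      - ∑ i : Fin (k+1), ∑ j : Fin k,
          if (i.succAbove j : ℕ) < (i : ℕ) then
            symT m V₁ V₂ (i.removeNth (Function.update v (i.succAbove j)
              (h (v (i.succAbove j)) • v i + h (v i) • v (i.succAbove j)))) A
          else 0

/-- The model for `⊕_{k=0}^K S^k ℝ^m ⊗ Hom(V₁,V₂)`. -/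
abbrev SymbT (K : ℕ) := ∀ k : Fin (K+1), Symb m V₁ V₂ (k : ℕ)

/-- The degree-wise representation `⊕_k σ^{(k)}` on `⊕_{k=0}^K S^k ℝ^m ⊗ Hom(V₁,V₂)`. -/
def sigmaT {K : ℕ} (B : GLm m) (T : SymbT m V₁ V₂ K) : SymbT m V₁ V₂ K :=
  fun k => sigmaS m V₁ V₂ σ₁ σ₂ B (T k)

/-- The extension of a family `γ` to `⊕_{k=0}^K S^k ℝ^m ⊗ Hom(V₁,V₂)` (lowering degree). -/
def gTot {K : ℕ} (γf : ∀ k : ℕ, Dualm m → (Symb m V₁ V₂ (k+1) →ₗ[ℝ] Symb m V₁ V₂ k))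
    (h : Dualm m) (T : SymbT m V₁ V₂ K) : SymbT m V₁ V₂ K :=
  fun k => if hk : (k : ℕ) + 1 < K + 1 then γf (k : ℕ) h (T ⟨(k : ℕ) + 1, hk⟩) else 0


/-- The action `ρ^{(k)}(a) = S^k a ⊗ (Φ ↦ ρ₂(a)∘Φ∘ρ₁(a)⁻¹)` of `GL(m,ℝ)` on
`S^k ℝ^m ⊗ Hom(V₁,V₂)`, in the model. -/
def rhoK {k : ℕ} (a : (Fin m → ℝ) ≃L[ℝ] (Fin m → ℝ)) (r₁ : V₁ ≃L[ℝ] V₁) (r₂ : V₂ ≃L[ℝ] V₂)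
    (T : Symb m V₁ V₂ k) : Symb m V₁ V₂ k :=
  ((ContinuousLinearMap.compL ℝ V₁ V₂ V₂ (r₂ : V₂ →L[ℝ] V₂)) ∘L
    ((ContinuousLinearMap.compL ℝ V₁ V₁ V₂).flip
      ((r₁.symm : V₁ →L[ℝ] V₁)))).compContinuousMultilinearMap
    (T.compContinuousLinearMap
      (fun _ => (ContinuousLinearMap.compL ℝ (Rm m) (Rm m) ℝ).flip
        (a : (Fin m → ℝ) →L[ℝ] (Fin m → ℝ))))

end Symbols

section Matrices

variable (m : ℕ)

/-- The element of `𝔤₁ ⊂ sl(m+1,ℝ)` with `ξ`-block the covector `h`. -/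
def hMat (h : Dualm m) : Matrix (Idx m) (Idx m) ℝ :=
  Matrix.fromBlocks 0 0 (Matrix.of fun _ j => h (Pi.single j 1)) 0

/-- The element of `𝔤₋₁ ⊂ sl(m+1,ℝ)` with `v`-block the vector `X`. -/
def XMat (X : Rm m) : Matrix (Idx m) (Idx m) ℝ :=
  Matrix.fromBlocks 0 (Matrix.of fun i _ => X i) 0 0

/-- The lift `B̃ ∈ 𝔤₀ ⊂ sl(m+1,ℝ)` of `B ∈ gl(m,ℝ)`, with `ψ(B̃) = B`. -/
def BTilde (B : GLm m) : Matrix (Idx m) (Idx m) ℝ :=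
  Matrix.fromBlocks
    (LinearMap.toMatrix' (B : (Fin m → ℝ) →ₗ[ℝ] (Fin m → ℝ))
      - ((LinearMap.trace ℝ (Rm m) (B : (Fin m → ℝ) →ₗ[ℝ] (Fin m → ℝ))) / ((m : ℝ) + 1)) • 1)
    0 0
    (Matrix.of fun _ _ => -(LinearMap.trace ℝ (Rm m) (B : (Fin m → ℝ) →ₗ[ℝ] (Fin m → ℝ))) / ((m : ℝ) + 1))

/-- The map `ψ : 𝔤₀ → gl(m,ℝ) : [[A,0],[0,a]] ↦ A - a·Id`. -/
def psiC (M : Matrix (Idx m) (Idx m) ℝ) : GLm m :=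
  LinearMap.toContinuousLinearMap
    ((Matrix.of fun i j => M (Sum.inl i) (Sum.inl j)).mulVecLin
      - M (Sum.inr ()) (Sum.inr ()) • LinearMap.id)

/-- The basis `(eᵢ)` of `𝔤₋₁`, corresponding to the standard basis of `ℝ^m`. -/
def eMat (i : Fin m) : Matrix (Idx m) (Idx m) ℝ := XMat m (Pi.single i 1)

/-- The covector `εⁱ = (1/(2(m+1))) δⁱ ∈ ℝ^{m*}`. -/
def epsD (i : Fin m) : Dualm m := (1 / (2 * ((m : ℝ) + 1))) • coordD m i

/-- The basis `(εⁱ)` of `𝔤₁`, Killing-dual to `(eᵢ)`. -/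
def epsMat (i : Fin m) : Matrix (Idx m) (Idx m) ℝ := hMat m (epsD m i)

/-- The Euler element `E = diag(-1/(m+1), …, -1/(m+1), m/(m+1)) ∈ 𝔤₀`, with `ψ(E) = -Id`. -/
def EMat : Matrix (Idx m) (Idx m) ℝ :=
  Matrix.fromBlocks ((-(1 / ((m : ℝ) + 1))) • 1) 0 0 (Matrix.of fun _ _ => (m : ℝ) / ((m : ℝ) + 1))

/-- Membership in `𝔰 ≅ sl(m,ℝ) ⊂ 𝔤₀`: block diagonal with vanishing corner and traceless. -/
def inS (M : Matrix (Idx m) (Idx m) ℝ) : Prop :=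
  (∀ i, M (Sum.inl i) (Sum.inr ()) = 0) ∧ (∀ j, M (Sum.inr ()) (Sum.inl j) = 0) ∧
    M (Sum.inr ()) (Sum.inr ()) = 0 ∧ Matrix.trace M = 0

/-- Membership in `𝔤₋₁`: only the `v`-block is nonzero. -/
def inGm1 (M : Matrix (Idx m) (Idx m) ℝ) : Prop :=
  (∀ i j, M (Sum.inl i) (Sum.inl j) = 0) ∧ (∀ j, M (Sum.inr ()) (Sum.inl j) = 0) ∧
    M (Sum.inr ()) (Sum.inr ()) = 0

/-- Membership in `𝔤₁`: only the `ξ`-block is nonzero. -/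
def inG1 (M : Matrix (Idx m) (Idx m) ℝ) : Prop :=
  (∀ i j, M (Sum.inl i) (Sum.inl j) = 0) ∧ (∀ i, M (Sum.inl i) (Sum.inr ()) = 0) ∧
    M (Sum.inr ()) (Sum.inr ()) = 0

/-- Membership in `𝔤₀`: block diagonal. -/
def inG0 (M : Matrix (Idx m) (Idx m) ℝ) : Prop :=
  (∀ i, M (Sum.inl i) (Sum.inr ()) = 0) ∧ (∀ j, M (Sum.inr ()) (Sum.inl j) = 0)

/-- The Killing form of `sl(m+1,ℝ)`: `κ(M,N) = 2(m+1) tr(MN)`. -/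
def kappa (M N : Matrix (Idx m) (Idx m) ℝ) : ℝ := 2 * ((m : ℝ) + 1) * Matrix.trace (M * N)

end Matrices

section SymbolOperators

variable (m : ℕ) (V₁ V₂ : Type)
  [NormedAddCommGroup V₁] [NormedSpace ℝ V₁] [NormedAddCommGroup V₂] [NormedSpace ℝ V₂]
  (σ₁ : GLm m →ₗ[ℝ] (V₁ →L[ℝ] V₁)) (σ₂ : GLm m →ₗ[ℝ] (V₂ →L[ℝ] V₂))

/-- The operator `C₀ = (1/2)σ^{(k)}(Id) + (1/2m)σ^{(k)}(Id)² + Σ_s σ^{(k)}(ψ(h_s))∘σ^{(k)}(ψ(h_s^*))`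
on `S^k ℝ^m ⊗ Hom(V₁,V₂)`. -/
def C0op {k : ℕ} {n : ℕ} (hs hs' : Fin n → Matrix (Idx m) (Idx m) ℝ)
    (T : Symb m V₁ V₂ k) : Symb m V₁ V₂ k :=
  (1/2 : ℝ) • sigmaS m V₁ V₂ σ₁ σ₂ (ContinuousLinearMap.id ℝ (Rm m)) T
  + (1/(2*(m : ℝ))) • sigmaS m V₁ V₂ σ₁ σ₂ (ContinuousLinearMap.id ℝ (Rm m))
      (sigmaS m V₁ V₂ σ₁ σ₂ (ContinuousLinearMap.id ℝ (Rm m)) T)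
  + ∑ s, sigmaS m V₁ V₂ σ₁ σ₂ (psiC m (hs s)) (sigmaS m V₁ V₂ σ₁ σ₂ (psiC m (hs' s)) T)

/-- `C₀` acting degreewise on `⊕_{k=0}^K S^k ℝ^m ⊗ Hom(V₁,V₂)`. -/
def C0tot {K : ℕ} {n : ℕ} (hs hs' : Fin n → Matrix (Idx m) (Idx m) ℝ)
    (T : SymbT m V₁ V₂ K) : SymbT m V₁ V₂ K :=
  fun k => C0op m V₁ V₂ σ₁ σ₂ hs hs' (T k)

/-- The operator `𝓛_M = L_{X^M} + γ(ξ_M)` (flat curly Lie derivative) on functions with values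
in `⊕_{k=0}^K S^k ℝ^m ⊗ Hom(V₁,V₂)`, where `ξ_M` is the `𝔤₁`-component of `M`. -/
def curlyL {K : ℕ} (γf : ∀ k : ℕ, Dualm m → (Symb m V₁ V₂ (k+1) →ₗ[ℝ] Symb m V₁ V₂ k))
    (M : Matrix (Idx m) (Idx m) ℝ) (f : Rm m → SymbT m V₁ V₂ K) : Rm m → SymbT m V₁ V₂ K :=
  fun x => lieD m (fun B T => sigmaT m V₁ V₂ σ₁ σ₂ B T) (projVF m M) f x
    + gTot m V₁ V₂ γf (∑ j, M (Sum.inr ()) (Sum.inl j) • coordD m j) (f x)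

end SymbolOperators

section Curved

variable (m : ℕ) (P : Type) [NormedAddCommGroup P] [NormedSpace ℝ P]

/-- The invariant derivative `L_{ω^{-1}(Z)} f` along the `ω`-constant vector field `η Z`. -/
def LD (η : Matrix (Idx m) (Idx m) ℝ → P → P) (Z : Matrix (Idx m) (Idx m) ℝ)
    {V : Type} [NormedAddCommGroup V] [NormedSpace ℝ V] (f : P → V) : P → V :=
  fun u => fderiv ℝ f u (η Z u)

/-- The bracket compatibility satisfied by a normal Cartan connection: for `M ∈ 𝔤₀ ⊕ 𝔤₁` and
`N ∈ 𝔤₋₁`, `L_{ω^{-1}(M)} ∘ L_{ω^{-1}(N)} - L_{ω^{-1}(N)} ∘ L_{ω^{-1}(M)} = L_{ω^{-1}([M,N])}` on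
smooth vector-space-valued functions. -/
def BracketCompat (η : Matrix (Idx m) (Idx m) ℝ → P → P) : Prop :=
  ∀ (V : Type) [NormedAddCommGroup V] [NormedSpace ℝ V],
    ∀ f : P → V, ContDiff ℝ (⊤ : ℕ∞) f →
      ∀ M N : Matrix (Idx m) (Idx m) ℝ, Matrix.trace M = 0 → Matrix.trace N = 0 →
        (∀ i, M (Sum.inl i) (Sum.inr ()) = 0) → inGm1 m N →
        (LD m P η M (LD m P η N f) - LD m P η N (LD m P η M f)) = LD m P η (M * N - N * M) f

/-- Infinitesimal `G₀`-equivariance of `f : P → V` with respect to `σ`: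
`L_{ω^{-1}(B̃)} f = -σ(B) f` for all `B ∈ gl(m,ℝ)`. -/
def equivG0 (η : Matrix (Idx m) (Idx m) ℝ → P → P)
    {V : Type} [NormedAddCommGroup V] [NormedSpace ℝ V]
    (σ : GLm m → V → V) (f : P → V) : Prop :=
  ∀ B : GLm m, LD m P η (BTilde m B) f = fun u => -(σ B (f u))

/-- Iterated invariant derivatives along `𝔤₋₁`-constant fields. -/
def iterL (η : Matrix (Idx m) (Idx m) ℝ → P → P)
    {V : Type} [NormedAddCommGroup V] [NormedSpace ℝ V] :
    (k : ℕ) → (Fin k → Rm m) → (P → V) → (P → V)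
  | 0, _, f => f
  | (k+1), v, f => LD m P η (XMat m (v 0)) (iterL η k (fun j => v j.succ) f)

/-- The symmetrized iterated invariant differential `(∇^ω)^k f`, evaluated on
`(X₁, …, X_k) ∈ (ℝ^m)^k`. -/
def nabK (η : Matrix (Idx m) (Idx m) ℝ → P → P)
    {V : Type} [NormedAddCommGroup V] [NormedSpace ℝ V]
    (k : ℕ) (f : P → V) (v : Fin k → Rm m) : P → V :=
  fun u => (k.factorial : ℝ)⁻¹ • ∑ ν : Equiv.Perm (Fin k), iterL m P η k (v ∘ ν) f u

variable (V₁ V₂ : Type)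
  [NormedAddCommGroup V₁] [NormedSpace ℝ V₁] [NormedAddCommGroup V₂] [NormedSpace ℝ V₂]

/-- The curved quantization map: `Q_ω(T)(f)(u) = ⟨T(u), (∇^ω)^k f(u)⟩` (full contraction). -/
def Qom (η : Matrix (Idx m) (Idx m) ℝ → P → P) {k : ℕ}
    (T : P → Symb m V₁ V₂ k) (f : P → V₁) : P → V₂ :=
  fun u => (k.factorial : ℝ)⁻¹ • ∑ d : Fin k → Fin m,
    (T u (fun t => coordD m (d t))) (nabK m P η k f (fun t => Pi.single (d t) 1) u)


/-- The curved operator `N^ω f = -2 Σᵢ γ(εⁱ)(L_{ω^{-1}(eᵢ)} f)`. -/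
def Nom {K : ℕ} (γf : ∀ k : ℕ, Dualm m → (Symb m V₁ V₂ (k+1) →ₗ[ℝ] Symb m V₁ V₂ k))
    (η : Matrix (Idx m) (Idx m) ℝ → P → P) (f : P → SymbT m V₁ V₂ K) : P → SymbT m V₁ V₂ K :=
  fun u => (-2 : ℝ) • ∑ i : Fin m, gTot m V₁ V₂ γf (epsD m i)
    (LD m P η (XMat m (Pi.single i 1)) f u)

end Curved


section Equivariance

variable (m : ℕ) (V₁ V₂ : Type)
  [NormedAddCommGroup V₁] [NormedSpace ℝ V₁] [NormedAddCommGroup V₂] [NormedSpace ℝ V₂]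

/-- The action `ρ^{(k)}(a)` as a linear map. -/
def rhoKLin (k : ℕ) (a : (Fin m → ℝ) ≃L[ℝ] (Fin m → ℝ)) (r₁ : V₁ ≃L[ℝ] V₁)
    (r₂ : V₂ ≃L[ℝ] V₂) : Symb m V₁ V₂ k →ₗ[ℝ] Symb m V₁ V₂ k where
  toFun := rhoK m V₁ V₂ a r₁ r₂
  map_add' S T := by
    ext ξ x
    simp [rhoK]
  map_smul' c T := by
    ext ξ x
    simp [rhoK]

variable {m V₁ V₂}

theorem rhoKLin_sub {k : ℕ} (a : (Fin m → ℝ) ≃L[ℝ] (Fin m → ℝ)) (r₁ : V₁ ≃L[ℝ] V₁)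
    (r₂ : V₂ ≃L[ℝ] V₂) (S T : Symb m V₁ V₂ k) :
    rhoKLin m V₁ V₂ k a r₁ r₂ (S - T) =
      rhoKLin m V₁ V₂ k a r₁ r₂ S - rhoKLin m V₁ V₂ k a r₁ r₂ T := by
  ext ξ x
  simp [rhoKLin, rhoK]

theorem rhoKLin_pureT {k : ℕ} (a : (Fin m → ℝ) ≃L[ℝ] (Fin m → ℝ)) (r₁ : V₁ ≃L[ℝ] V₁)
    (r₂ : V₂ ≃L[ℝ] V₂) (v : Fin k → Rm m) (A : V₁ →L[ℝ] V₂) :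
    rhoKLin m V₁ V₂ k a r₁ r₂ (pureT m V₁ V₂ v A) =
      pureT m V₁ V₂ (fun i => a (v i))
        ((r₂ : V₂ →L[ℝ] V₂) ∘L A ∘L (r₁.symm : V₁ →L[ℝ] V₁)) := by
  ext ξ x
  simp [rhoKLin, rhoK, pureT]

theorem rhoKLin_symT {k : ℕ} (a : (Fin m → ℝ) ≃L[ℝ] (Fin m → ℝ)) (r₁ : V₁ ≃L[ℝ] V₁)
    (r₂ : V₂ ≃L[ℝ] V₂) (v : Fin k → Rm m) (A : V₁ →L[ℝ] V₂) :
    rhoKLin m V₁ V₂ k a r₁ r₂ (symT m V₁ V₂ v A) =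
      symT m V₁ V₂ (fun i => a (v i))
        ((r₂ : V₂ →L[ℝ] V₂) ∘L A ∘L (r₁.symm : V₁ →L[ℝ] V₁)) := by
  simp only [symT, map_sum, rhoKLin_pureT]
  rfl

theorem conj_rkOne_add_smul_id (a : (Fin m → ℝ) ≃L[ℝ] (Fin m → ℝ)) (u : Rm m) (h : Dualm m)
    (c : ℝ) :
    (a : GLm m) ∘L (rkOne m u h + c • ContinuousLinearMap.id ℝ (Rm m)) ∘L (a.symm : GLm m) =
      rkOne m (a u) (h ∘L (a.symm : GLm m)) + c • ContinuousLinearMap.id ℝ (Rm m) := by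
  refine ContinuousLinearMap.ext fun x => ?_
  simp [rkOne]

end Equivariance

/-- equivariance of `γ` under `GL(m,ℝ)`:
`ρ^{(k-1)}(a)(γ(h)u) = γ(h∘a⁻¹)(ρ^{(k)}(a)u)`. -/
theorem statement7 (m k : ℕ) (hm : 2 ≤ m)
    (V₁ V₂ : Type) [NormedAddCommGroup V₁] [NormedSpace ℝ V₁] [FiniteDimensional ℝ V₁]
    [NormedAddCommGroup V₂] [NormedSpace ℝ V₂] [FiniteDimensional ℝ V₂]
    (σ₁ : GLm m →ₗ[ℝ] (V₁ →L[ℝ] V₁)) (hσ₁ : IsLieRep m σ₁)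
    (σ₂ : GLm m →ₗ[ℝ] (V₂ →L[ℝ] V₂)) (hσ₂ : IsLieRep m σ₂)
    (ρ₁ : ((Fin m → ℝ) ≃L[ℝ] (Fin m → ℝ)) →* (V₁ ≃L[ℝ] V₁))
    (ρ₂ : ((Fin m → ℝ) ≃L[ℝ] (Fin m → ℝ)) →* (V₂ ≃L[ℝ] V₂))
    (hcomp₁ : ∀ (a : (Fin m → ℝ) ≃L[ℝ] (Fin m → ℝ)) (B : GLm m) (u : V₁),
      ρ₁ a (σ₁ B ((ρ₁ a).symm u))
        = σ₁ ((a : GLm m) ∘L B ∘L ((a.symm : GLm m))) u)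
    (hcomp₂ : ∀ (a : (Fin m → ℝ) ≃L[ℝ] (Fin m → ℝ)) (B : GLm m) (u : V₂),
      ρ₂ a (σ₂ B ((ρ₂ a).symm u))
        = σ₂ ((a : GLm m) ∘L B ∘L ((a.symm : GLm m))) u)
    (γ : Dualm m → (Symb m V₁ V₂ (k+1) →ₗ[ℝ] Symb m V₁ V₂ k))
    (hγ : gammaProp m V₁ V₂ σ₁ γ)
    (a : (Fin m → ℝ) ≃L[ℝ] (Fin m → ℝ)) (h : Dualm m) :
    ∀ u ∈ spanGen m V₁ V₂ (k+1),
      rhoK m V₁ V₂ a (ρ₁ a) (ρ₂ a) (γ h u)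
        = γ (h ∘L (a.symm : GLm m)) (rhoK m V₁ V₂ a (ρ₁ a) (ρ₂ a) u) := by
  intro u hu
  change rhoKLin m V₁ V₂ k a (ρ₁ a) (ρ₂ a) (γ h u)
    = γ (h ∘L (a.symm : GLm m)) (rhoKLin m V₁ V₂ (k + 1) a (ρ₁ a) (ρ₂ a) u)
  induction hu using Submodule.span_induction with
  | zero => simp only [map_zero]
  | add x y _ _ hx hy => simp only [map_add, hx, hy]
  | smul c x _ hx => simp only [map_smul, hx]
  | mem x hx =>
    obtain ⟨v, A, rfl⟩ := hx
    rw [rhoKLin_symT, hγ, hγ]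
    rw [rhoKLin_sub, map_sum, map_sum]
    congr 1
    · refine Finset.sum_congr rfl fun i _ => ?_
      rw [rhoKLin_symT]
      congr 1
      ext x
      have key := hcomp₁ a (rkOne m (v i) h + h (v i) • ContinuousLinearMap.id ℝ (Rm m)) x
      rw [conj_rkOne_add_smul_id] at key
      simp only [ContinuousLinearMap.comp_apply, ContinuousLinearEquiv.coe_coe,
        ContinuousLinearEquiv.symm_apply_apply]
      rw [← key, ContinuousLinearEquiv.symm_apply_apply]
    · refine Finset.sum_congr rfl fun i _ => ?_
      rw [map_sum]
      refine Finset.sum_congr rfl fun j _ => ?_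
      split_ifs
      · rw [rhoKLin_symT]
        congr 1
        funext l
        simp only [Fin.removeNth, Function.update_apply]
        split_ifs <;> simp
      · rw [map_zero]

end ProjQuant
end
end

section
/- For all B ∈ gl(m,ℝ) and h ∈ ℝ^{m*} ≅ g₁, one has σ^(k−1)(B)∘γ(h) − γ(h)∘σ^(k)(B) = −γ(h∘B) as linear maps S^k ℝ^m ⊗ Hom(V₁,V₂) → S^{k−1} ℝ^m ⊗ Hom(V₁,V₂); here −h∘B is the adjoint action of g₀ ≅ gl(m,ℝ) on g₁ ≅ ℝ^{m*} inside sl(m+1,ℝ). -/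
open scoped BigOperators
noncomputable section
namespace ProjQuant

section Equivariance

variable (m : ℕ) {V₁ V₂ : Type}
  [NormedAddCommGroup V₁] [NormedSpace ℝ V₁] [NormedAddCommGroup V₂] [NormedSpace ℝ V₂]

theorem symT_apply {k : ℕ} (v : Fin k → Rm m) (A : V₁ →L[ℝ] V₂) (φ : Fin k → Dualm m) :
    symT m V₁ V₂ v A φ = (∑ ν : Equiv.Perm (Fin k), ∏ s, φ s (v (ν s))) • A := by
  simp [symT, pureT, Finset.sum_smul]

theorem symT_add_right {k : ℕ} (v : Fin k → Rm m) (A A' : V₁ →L[ℝ] V₂) :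
    symT m V₁ V₂ v (A + A') = symT m V₁ V₂ v A + symT m V₁ V₂ v A' := by
  ext1 φ
  simp only [symT_apply, add_apply, smul_add]

theorem symT_neg_right {k : ℕ} (v : Fin k → Rm m) (A : V₁ →L[ℝ] V₂) :
    symT m V₁ V₂ v (-A) = -symT m V₁ V₂ v A := by
  ext1 φ
  simp only [symT_apply, neg_apply, smul_neg]

theorem symT_update_add {k : ℕ} (v : Fin k → Rm m) (A : V₁ →L[ℝ] V₂) (j : Fin k) (x y : Rm m) :
    symT m V₁ V₂ (Function.update v j (x + y)) A
      = symT m V₁ V₂ (Function.update v j x) A + symT m V₁ V₂ (Function.update v j y) A := by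
  ext1 φ
  have key (ν : Equiv.Perm (Fin k)) (w : Fin k → Rm m) :
      ∏ s, φ s (w (ν s)) = (MultilinearMap.mkPiAlgebra ℝ (Fin k) ℝ).compLinearMap
        (fun t => (φ (ν.symm t) : Rm m →ₗ[ℝ] ℝ)) w := by
    simp only [MultilinearMap.compLinearMap_apply, MultilinearMap.mkPiAlgebra_apply]
    exact Fintype.prod_equiv ν _ _ (by simp)
  simp only [symT_apply, add_apply, ← add_smul, ← Finset.sum_add_distrib,
    key, MultilinearMap.map_update_add]

variable (σ₁ : GLm m →ₗ[ℝ] (V₁ →L[ℝ] V₁)) (σ₂ : GLm m →ₗ[ℝ] (V₂ →L[ℝ] V₂))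

theorem sigmaS_add {k : ℕ} (B : GLm m) (T T' : Symb m V₁ V₂ k) :
    sigmaS m V₁ V₂ σ₁ σ₂ B (T + T')
      = sigmaS m V₁ V₂ σ₁ σ₂ B T + sigmaS m V₁ V₂ σ₁ σ₂ B T' := by
  ext1 φ
  simp only [sigmaS, add_apply, sum_apply,
    ContinuousMultilinearMap.compContinuousLinearMap_apply, Finset.sum_add_distrib,
    ContinuousLinearMap.compContinuousMultilinearMap_coe, Function.comp_apply, map_add]
  abel

theorem sigmaS_smul {k : ℕ} (B : GLm m) (c : ℝ) (T : Symb m V₁ V₂ k) :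
    sigmaS m V₁ V₂ σ₁ σ₂ B (c • T) = c • sigmaS m V₁ V₂ σ₁ σ₂ B T := by
  ext1 φ
  simp only [sigmaS, add_apply, sum_apply,
    smul_apply,
    ContinuousMultilinearMap.compContinuousLinearMap_apply, ← Finset.smul_sum,
    ContinuousLinearMap.compContinuousMultilinearMap_coe, Function.comp_apply, map_smul, smul_add]

/-- `sigmaS` as a linear map. -/
def sigmaLin {k : ℕ} (B : GLm m) : Symb m V₁ V₂ k →ₗ[ℝ] Symb m V₁ V₂ k where
  toFun := sigmaS m V₁ V₂ σ₁ σ₂ B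
  map_add' := sigmaS_add m σ₁ σ₂ B
  map_smul' := sigmaS_smul m σ₁ σ₂ B

theorem sigmaLin_symT {k : ℕ} (B : GLm m) (v : Fin k → Rm m) (A : V₁ →L[ℝ] V₂) :
    sigmaLin m σ₁ σ₂ B (symT m V₁ V₂ v A)
      = (∑ t, symT m V₁ V₂ (Function.update v t (B (v t))) A)
        + symT m V₁ V₂ v (σ₂ B ∘L A - A ∘L σ₁ B) := by
  change sigmaS m V₁ V₂ σ₁ σ₂ B _ = _
  ext1 φ
  simp only [sigmaS, add_apply, sum_apply,
    ContinuousMultilinearMap.compContinuousLinearMap_apply,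
    ContinuousLinearMap.compContinuousMultilinearMap_coe, Function.comp_apply, symT_apply, map_smul]
  congr 1
  rw [← Finset.sum_smul, ← Finset.sum_smul, Finset.sum_comm]
  conv_rhs => rw [Finset.sum_comm]
  congr 1
  refine Finset.sum_congr rfl fun ν _ => Fintype.sum_equiv ν _ _ fun t => ?_
  refine Finset.prod_congr rfl fun s _ => ?_
  by_cases hs : s = t
  · subst hs; simp
  · simp [hs]

theorem removeNth_update_self {k : ℕ} (i : Fin (k+1)) (v : Fin (k+1) → Rm m) (x : Rm m) :
    i.removeNth (Function.update v i x) = i.removeNth v := by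
  ext1 s
  simp [Fin.removeNth]

theorem removeNth_update_succAbove {k : ℕ} (i : Fin (k+1)) (j : Fin k) (v : Fin (k+1) → Rm m)
    (x : Rm m) :
    i.removeNth (Function.update v (i.succAbove j) x)
      = Function.update (i.removeNth v) j x := by
  ext1 s
  by_cases hs : s = j
  · subst hs; simp [Fin.removeNth]
  · simp [Fin.removeNth, hs]

/-- The endomorphism `x ⊗ h + h(x) • Id` through which `𝔤₁` acts on `V₁`. -/
def gammaEnd (x : Rm m) (h : Dualm m) : GLm m :=
  rkOne m x h + h x • ContinuousLinearMap.id ℝ (Rm m)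

theorem commutator_gammaEnd (B : GLm m) (x : Rm m) (h : Dualm m) :
    B ∘L gammaEnd m x h - gammaEnd m x h ∘L B
      = gammaEnd m (B x) h - gammaEnd m x (h ∘L B) := by
  ext1 y
  simp [gammaEnd, rkOne]

/-- The terms of `γ(h)` that involve `σ₁`. -/
def gammaRep {k : ℕ} (h : Dualm m) (v : Fin (k+1) → Rm m) (A : V₁ →L[ℝ] V₂) (i : Fin (k+1)) :
    Symb m V₁ V₂ k :=
  symT m V₁ V₂ (i.removeNth v) (A ∘L σ₁ (gammaEnd m (v i) h))

/-- The terms of `γ(h)` that contract two vectors. -/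
def gammaContr {k : ℕ} (h : Dualm m) (v : Fin (k+1) → Rm m) (A : V₁ →L[ℝ] V₂)
    (i : Fin (k+1)) (j : Fin k) : Symb m V₁ V₂ k :=
  symT m V₁ V₂ (Function.update (i.removeNth v) j
    (h (v (i.succAbove j)) • v i + h (v i) • v (i.succAbove j))) A

variable {m} in
theorem gammaProp.apply_symT {σ₁ : GLm m →ₗ[ℝ] (V₁ →L[ℝ] V₁)} {k : ℕ}
    {γ : Dualm m → (Symb m V₁ V₂ (k+1) →ₗ[ℝ] Symb m V₁ V₂ k)}
    (hγ : gammaProp m V₁ V₂ σ₁ γ) (h : Dualm m) (v : Fin (k+1) → Rm m) (A : V₁ →L[ℝ] V₂) :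
    γ h (symT m V₁ V₂ v A) = (∑ i, gammaRep m σ₁ h v A i)
      - ∑ i : Fin (k+1), ∑ j : Fin k,
          if (i.succAbove j : ℕ) < (i : ℕ) then gammaContr m h v A i j else 0 := by
  simp only [hγ h v A, removeNth_update_succAbove]
  rfl

theorem sigmaLin_gammaRep (hσ₁ : IsLieRep m σ₁) {k : ℕ} (B : GLm m) (h : Dualm m)
    (v : Fin (k+1) → Rm m) (A : V₁ →L[ℝ] V₂) (i : Fin (k+1)) :
    sigmaLin m σ₁ σ₂ B (gammaRep m σ₁ h v A i)
      = (∑ t, gammaRep m σ₁ h (Function.update v t (B (v t))) A i)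
        + gammaRep m σ₁ h v (σ₂ B ∘L A - A ∘L σ₁ B) i - gammaRep m σ₁ (h ∘L B) v A i := by
  have hcomm : σ₂ B ∘L (A ∘L σ₁ (gammaEnd m (v i) h)) - (A ∘L σ₁ (gammaEnd m (v i) h)) ∘L σ₁ B
      = A ∘L σ₁ (gammaEnd m (B (v i)) h)
        + (σ₂ B ∘L A - A ∘L σ₁ B) ∘L σ₁ (gammaEnd m (v i) h)
        + -(A ∘L σ₁ (gammaEnd m (v i) (h ∘L B))) := by
    have e := hσ₁ B (gammaEnd m (v i) h)
    rw [commutator_gammaEnd, map_sub] at e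
    ext1 x
    have ex := congrArg A (DFunLike.congr_fun e x)
    simp only [sub_apply, ContinuousLinearMap.comp_apply, map_sub] at ex
    simp only [sub_apply, ContinuousLinearMap.comp_apply,
      add_apply, neg_apply]
    rw [sub_eq_sub_iff_add_eq_add] at ex
    rw [← sub_eq_zero] at ex ⊢
    rw [← neg_eq_zero, ← ex]
    abel
  rw [Fin.sum_univ_succAbove _ i]
  simp only [gammaRep, sigmaLin_symT, hcomm, symT_add_right, symT_neg_right,
    removeNth_update_self, removeNth_update_succAbove, Function.update_self,
    Function.update_of_ne (Fin.succAbove_ne i _).symm]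
  simp only [Fin.removeNth]
  abel

theorem sigmaLin_gammaContr {k : ℕ} (B : GLm m) (h : Dualm m)
    (v : Fin (k+1) → Rm m) (A : V₁ →L[ℝ] V₂) (i : Fin (k+1)) (j : Fin k) :
    sigmaLin m σ₁ σ₂ B (gammaContr m h v A i j)
      = (∑ t, gammaContr m h (Function.update v t (B (v t))) A i j)
        + gammaContr m h v (σ₂ B ∘L A - A ∘L σ₁ B) i j - gammaContr m (h ∘L B) v A i j := by
  have hoff (s : Fin k) (hs : s ∈ Finset.univ.erase j) :
      gammaContr m h (Function.update v (i.succAbove s) (B (v (i.succAbove s)))) A i j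
      = symT m V₁ V₂ (Function.update (Function.update (i.removeNth v) j
          (h (v (i.succAbove j)) • v i + h (v i) • v (i.succAbove j))) s
            (B (i.removeNth v s))) A := by
    have hs : s ≠ j := Finset.ne_of_mem_erase hs
    have hs' : i.succAbove j ≠ i.succAbove s := fun e => hs (Fin.succAbove_right_injective e).symm
    simp only [gammaContr, removeNth_update_succAbove, Function.update_of_ne hs',
      Function.update_of_ne (Fin.succAbove_ne i _).symm]
    rw [Function.update_comm hs]
    rfl
  rw [Fin.sum_univ_succAbove _ i, ← Finset.add_sum_erase _ _ (Finset.mem_univ j),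
    Finset.sum_congr rfl hoff]
  simp only [gammaContr, sigmaLin_symT]
  rw [← Finset.add_sum_erase _ _ (Finset.mem_univ j)]
  have hupd : ∀ s ∈ Finset.univ.erase j, ∀ x : Rm m,
      Function.update (i.removeNth v) j x s = i.removeNth v s := fun s hs x =>
    Function.update_of_ne (Finset.ne_of_mem_erase hs) _ _
  rw [Finset.sum_congr rfl fun s hs => by rw [hupd s hs]]
  simp only [removeNth_update_self, removeNth_update_succAbove, Function.update_self,
    Function.update_idem, Function.update_of_ne (Fin.succAbove_ne i _),
    Function.update_of_ne (Fin.succAbove_ne i _).symm, map_add, map_smul, symT_update_add,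
    ContinuousLinearMap.comp_apply]
  abel

theorem sigmaLin_gamma_symT (hσ₁ : IsLieRep m σ₁) {k : ℕ}
    {γ : Dualm m → (Symb m V₁ V₂ (k+1) →ₗ[ℝ] Symb m V₁ V₂ k)}
    (hγ : gammaProp m V₁ V₂ σ₁ γ) (B : GLm m) (h : Dualm m) (v : Fin (k+1) → Rm m)
    (A : V₁ →L[ℝ] V₂) :
    sigmaLin m σ₁ σ₂ B (γ h (symT m V₁ V₂ v A))
      = γ h (sigmaLin m σ₁ σ₂ B (symT m V₁ V₂ v A)) - γ (h ∘L B) (symT m V₁ V₂ v A) := by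
  have hcontr (i : Fin (k+1)) (j : Fin k) :
      sigmaLin m σ₁ σ₂ B (if (i.succAbove j : ℕ) < (i : ℕ) then gammaContr m h v A i j else 0)
      = (∑ t, if (i.succAbove j : ℕ) < (i : ℕ) then
            gammaContr m h (Function.update v t (B (v t))) A i j else 0)
        + (if (i.succAbove j : ℕ) < (i : ℕ) then
            gammaContr m h v (σ₂ B ∘L A - A ∘L σ₁ B) i j else 0)
        - (if (i.succAbove j : ℕ) < (i : ℕ) then gammaContr m (h ∘L B) v A i j else 0) := by
    split_ifs
    · exact sigmaLin_gammaContr m σ₁ σ₂ B h v A i j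
    · simp only [map_zero, Finset.sum_const_zero, add_zero]
      exact (sub_zero (0 : Symb m V₁ V₂ k)).symm
  have hmap (x y : Symb m V₁ V₂ k) :
      sigmaLin m σ₁ σ₂ B (x - y) = sigmaLin m σ₁ σ₂ B x - sigmaLin m σ₁ σ₂ B y := by
    have e := map_add (sigmaLin m σ₁ σ₂ B) (x - y) y
    rw [show x - y + y = x by abel] at e
    rw [e]
    abel
  have hsum {n : ℕ} (f g : Fin n → Symb m V₁ V₂ k) :
      ∑ x, (f x - g x) = ∑ x, f x - ∑ x, g x := Finset.sum_sub_distrib f g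
  rw [sigmaLin_symT, map_add, map_sum]
  simp only [hγ.apply_symT, hmap, map_sum, sigmaLin_gammaRep m σ₁ σ₂ hσ₁, hcontr,
    Finset.sum_add_distrib, hsum]
  rw [Finset.sum_comm (f := fun t i => gammaRep m σ₁ h (Function.update v t (B (v t))) A i),
    Finset.sum_comm (s := Finset.univ (α := Fin (k+1))) (t := Finset.univ (α := Fin (k+1)))
      (f := fun t i => ∑ j : Fin k, if (i.succAbove j : ℕ) < (i : ℕ) then
            gammaContr m h (Function.update v t (B (v t))) A i j else 0)]
  rw [Finset.sum_congr rfl fun (i : Fin (k+1)) _ => Finset.sum_comm (s := Finset.univ (α := Fin (k+1)))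
      (t := Finset.univ (α := Fin k))
      (f := fun t j => if (i.succAbove j : ℕ) < (i : ℕ) then
            gammaContr m h (Function.update v t (B (v t))) A i j else 0)]
  abel

end Equivariance

/-- `σ^{(k-1)}(B)∘γ(h) - γ(h)∘σ^{(k)}(B) = -γ(h∘B)`. -/
theorem statement8 (m k : ℕ) (hm : 2 ≤ m)
    (V₁ V₂ : Type) [NormedAddCommGroup V₁] [NormedSpace ℝ V₁] [FiniteDimensional ℝ V₁]
    [NormedAddCommGroup V₂] [NormedSpace ℝ V₂] [FiniteDimensional ℝ V₂]
    (σ₁ : GLm m →ₗ[ℝ] (V₁ →L[ℝ] V₁)) (hσ₁ : IsLieRep m σ₁)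
    (σ₂ : GLm m →ₗ[ℝ] (V₂ →L[ℝ] V₂)) (hσ₂ : IsLieRep m σ₂)
    (γ : Dualm m → (Symb m V₁ V₂ (k+1) →ₗ[ℝ] Symb m V₁ V₂ k))
    (hγ : gammaProp m V₁ V₂ σ₁ γ)
    (B : GLm m) (h : Dualm m) :
    ∀ u ∈ spanGen m V₁ V₂ (k+1),
      sigmaS m V₁ V₂ σ₁ σ₂ B (γ h u) - γ h (sigmaS m V₁ V₂ σ₁ σ₂ B u)
        = -(γ (h ∘L B) u) := by
  intro u hu
  have key : Set.EqOn (sigmaLin m σ₁ σ₂ B ∘ₗ γ h + γ (h ∘L B)) (γ h ∘ₗ sigmaLin m σ₁ σ₂ B)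
      (spanGen m V₁ V₂ (k+1)) := by
    apply LinearMap.eqOn_span
    rintro _ ⟨v, A, rfl⟩
    simp only [LinearMap.add_apply, LinearMap.comp_apply, sigmaLin_gamma_symT m σ₁ σ₂ hσ₁ hγ]
    abel
  have hu' : sigmaS m V₁ V₂ σ₁ σ₂ B (γ h u) + γ (h ∘L B) u
      = γ h (sigmaS m V₁ V₂ σ₁ σ₂ B u) := key hu
  rw [← hu']
  abel

end ProjQuant
end
end
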